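/- Let X be a median algebra of finite rank n. Then the VC-dimension of the dual set system ℋ(X)* of the family ℋ(X) of all halfspaces of X equals n; that is, the rank of X coincides with the dual VC-dimension of the halfspace system of X. -/

import Mathlib

open Set

/-- A median algebra: a ternary operation invariant under permutations of its
arguments, with `m x y y = y` and the standard associativity law. -/
structure MedianStruct (X : Type*) where
  med : X → X → X → X
  med_perm : ∀ (σ : Equiv.Perm (Fin 3)) (v : Fin 3 → X),
    med (v (σ 0)) (v (σ 1)) (v (σ 2)) = med (v 0) (v 1) (v 2)
  med_idem : ∀ x y : X, med x y y = y
  med_assoc : ∀ x y z u w : X,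
    med (med x y z) u w = med x (med y u w) (med z u w)

namespace MedianStruct

variable {X : Type*}

/-- The interval `[x,y] = {z | m x y z = z}`. -/
def interval (M : MedianStruct X) (x y : X) : Set X := {z | M.med x y z = z}

/-- A set is convex if it contains the interval between any two of its points. -/
def IsConvex (M : MedianStruct X) (C : Set X) : Prop :=
  ∀ x ∈ C, ∀ y ∈ C, M.interval x y ⊆ C

/-- A halfspace: a convex set with convex complement. -/
def IsHalfspace (M : MedianStruct X) (H : Set X) : Prop :=
  M.IsConvex H ∧ M.IsConvex Hᶜ

end MedianStruct

/-- Two sets are crossing if all four intersections of them/their complements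
are nonempty. -/
def Crossing {X : Type*} (A B : Set X) : Prop :=
  (A ∩ B).Nonempty ∧ (A ∩ Bᶜ).Nonempty ∧ (Aᶜ ∩ B).Nonempty ∧ (Aᶜ ∩ Bᶜ).Nonempty

/-- A finite family of sets is (Rosenthal) independent. -/
def IndepSetFamily {X : Type*} {k : ℕ} (A : Fin k → Set X) : Prop :=
  ∀ P M : Finset (Fin k), Disjoint P M →
    ((⋂ i ∈ P, A i) ∩ ⋂ j ∈ M, (A j)ᶜ).Nonempty

/-- The independence number of a family of sets: the supremum of the sizes of
independent finite subfamilies. -/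
noncomputable def indSets {X : Type*} (𝒞 : Set (Set X)) : ℕ∞ :=
  ⨆ (k : ℕ) (_ : ∃ A : Fin k → Set X,
      (∀ i, A i ∈ 𝒞) ∧ Function.Injective A ∧ IndepSetFamily A), (k : ℕ∞)

/-- Majority (median) operation on `Bool`. -/
def boolMed (a b c : Bool) : Bool := (a && b) || (b && c) || (a && c)

/-- The coordinatewise majority median on a power of `Bool`. -/
def boolCubeMed (I : Type*) : MedianStruct (I → Bool) where
  med x y z := fun i => boolMed (x i) (y i) (z i)
  med_perm σ v := by
    funext i
    exact (by decide :
      ∀ (τ : Equiv.Perm (Fin 3)) (w : Fin 3 → Bool),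
        boolMed (w (τ 0)) (w (τ 1)) (w (τ 2)) = boolMed (w 0) (w 1) (w 2))
      σ (fun j => v j i)
  med_idem x y := by
    funext i
    exact (by decide : ∀ a b : Bool, boolMed a b b = b) (x i) (y i)
  med_assoc x y z u w := by
    funext i
    exact (by decide : ∀ a b c d e : Bool,
        boolMed (boolMed a b c) d e = boolMed a (boolMed b d e) (boolMed c d e))
      (x i) (y i) (z i) (u i) (w i)

/-- A median-preserving (MP) map between median algebras. -/
def IsMedianHom {X Y : Type*} (M : MedianStruct X) (N : MedianStruct Y)
    (f : X → Y) : Prop :=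
  ∀ x y z, f (M.med x y z) = N.med (f x) (f y) (f z)

/-- The rank of a median algebra: the supremum of the `n` such that the Boolean
hypercube `{0,1}ⁿ` embeds into it by an injective median-preserving map. -/
noncomputable def medRank {X : Type*} (M : MedianStruct X) : ℕ∞ :=
  ⨆ (n : ℕ) (_ : ∃ f : (Fin n → Bool) → X,
      Function.Injective f ∧ IsMedianHom (boolCubeMed (Fin n)) M f), (n : ℕ∞)

/-- The median operation on `ℝ`. -/
noncomputable def realMed (a b c : ℝ) : ℝ := max (max (min a b) (min b c)) (min a c)

/-- A real-valued median-preserving function on a median algebra. -/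
def IsMedianPreserving {X : Type*} (M : MedianStruct X) (f : X → ℝ) : Prop :=
  ∀ x y z, f (M.med x y z) = realMed (f x) (f y) (f z)

/-- A finite sequence of real functions is independent with witnessing
constants `a < b`. -/
def IndepFunFinWith {X : Type*} {k : ℕ} (f : Fin k → X → ℝ) (a b : ℝ) : Prop :=
  ∀ P M : Finset (Fin k), Disjoint P M →
    ((⋂ i ∈ P, {x | f i x ≤ a}) ∩ ⋂ j ∈ M, {x | b ≤ f j x}).Nonempty

/-- A finite sequence of real functions is independent. -/
def IndepFunFin {X : Type*} {k : ℕ} (f : Fin k → X → ℝ) : Prop :=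
  ∃ a b : ℝ, a < b ∧ IndepFunFinWith f a b

/-- The independence number of a family of real functions: the supremum of the
lengths of independent finite sequences in the family. -/
noncomputable def indFun {X : Type*} (F : Set (X → ℝ)) : ℕ∞ :=
  ⨆ (k : ℕ) (_ : ∃ f : Fin k → X → ℝ, (∀ i, f i ∈ F) ∧ IndepFunFin f), (k : ℕ∞)

/-- An infinite sequence of real functions is independent. -/
def IndepFunSeq {X : Type*} (f : ℕ → X → ℝ) : Prop :=
  ∃ a b : ℝ, a < b ∧ ∀ P M : Finset ℕ, Disjoint P M →
    ((⋂ i ∈ P, {x | f i x ≤ a}) ∩ ⋂ j ∈ M, {x | b ≤ f j x}).Nonempty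

/-- A finite set `S` is shattered by a family of sets `𝒟`. -/
def Shatters {Y : Type*} (𝒟 : Set (Set Y)) (S : Finset Y) : Prop :=
  ∀ T : Set Y, T ⊆ ↑S → ∃ D ∈ 𝒟, D ∩ ↑S = T

/-- The VC-dimension of a family of sets. -/
noncomputable def vcDim {Y : Type*} (𝒟 : Set (Set Y)) : ℕ∞ :=
  ⨆ (k : ℕ) (_ : ∃ S : Finset Y, S.card = k ∧ Shatters 𝒟 S), (k : ℕ∞)

/-- The dual set system of `𝒞`: on the ground set `𝒞`, the sets
`R_x = {C ∈ 𝒞 | x ∈ C}` for `x ∈ X`. -/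
def dualSystem {X : Type*} (𝒞 : Set (Set X)) : Set (Set ↥𝒞) :=
  {R | ∃ x : X, R = {C : ↥𝒞 | x ∈ (C : Set X)}}

/-- The family of all continuous median-preserving maps `X → [0,1]`. -/
def MCfam {X : Type*} [TopologicalSpace X] (M : MedianStruct X) : Set (X → ℝ) :=
  {f | Continuous f ∧ IsMedianPreserving M f ∧ ∀ x, f x ∈ Set.Icc (0 : ℝ) 1}

namespace MedianStruct

variable {X : Type*} (M : MedianStruct X)

theorem med_swap_left (x y z : X) : M.med x y z = M.med y x z := by
  exact M.med_perm (Equiv.swap 0 1) ![y, x, z]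

theorem med_swap_right (x y z : X) : M.med x y z = M.med x z y := by
  exact M.med_perm (Equiv.swap 1 2) ![x, z, y]

theorem med_rotate (x y z : X) : M.med x y z = M.med y z x := by
  rw [M.med_swap_left, M.med_swap_right]

theorem med_self_left (x y : X) : M.med x x y = x := by
  rw [← M.med_rotate, M.med_idem]

theorem med_self_outer (x y : X) : M.med x y x = x := by
  rw [M.med_swap_left, M.med_idem]

/-- Distributivity of the median over its last argument. -/
theorem med_distrib (x y z u w : X) :
    M.med u w (M.med x y z) = M.med x (M.med u w y) (M.med u w z) := by
  rw [M.med_rotate u w, M.med_rotate w, M.med_assoc, M.med_rotate y u w, M.med_rotate z u w]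

theorem med_mem_interval (x y z : X) : M.med x y z ∈ M.interval x y := by
  change M.med x y (M.med x y z) = M.med x y z
  rw [← M.med_rotate z x y, M.med_distrib, M.med_self_outer, M.med_idem]

variable {M}

theorem IsConvex.med_mem {C : Set X} (hC : M.IsConvex C) {x y : X} (hx : x ∈ C) (hy : y ∈ C)
    (z : X) : M.med x y z ∈ C :=
  hC x hx y hy (M.med_mem_interval x y z)

/-- The union of the intervals from a point to the points of a convex set is convex. -/
theorem IsConvex.join_point {C : Set X} (hC : M.IsConvex C) (a : X) :
    M.IsConvex {z | ∃ c ∈ C, M.med a c z = z} := by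
  rintro z₁ ⟨c₁, h₁, e₁⟩ z₂ ⟨c₂, h₂, e₂⟩ z (hz : M.med z₁ z₂ z = z)
  refine ⟨M.med c₁ c₂ z, hC.med_mem h₁ h₂ z, ?_⟩
  have key : ∀ c z' : X, M.med a c z' = z' →
      M.med z z' (M.med a c z) = M.med a c z := by
    intro c z' e
    have h := M.med_distrib z z' z a c
    rw [e, M.med_self_outer] at h
    exact h.symm
  set u₁ := M.med a c₁ z with hu₁
  set u₂ := M.med a c₂ z with hu₂
  have k₁ : M.med z z₁ u₁ = u₁ := key c₁ z₁ e₁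
  have k₂ : M.med z z₂ u₂ = u₂ := key c₂ z₂ e₂
  have hw : M.med a (M.med c₁ c₂ z) z = M.med z u₁ u₂ := by
    rw [M.med_swap_right, M.med_rotate c₁, M.med_rotate c₂, M.med_distrib,
      M.med_swap_right a z c₁, M.med_swap_right a z c₂]
  rw [hw]
  set w := M.med z u₁ u₂ with hwdef
  have w₁ : M.med z z₁ w = w := by
    have h' := M.med_assoc z₁ z u₁ z u₂
    rw [M.med_swap_left z₁ z u₁, k₁, M.med_self_left, M.med_swap_left u₁ z u₂,
      M.med_swap_left z₁ z] at h'
    exact h'.symm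
  have w₂ : M.med z z₂ w = w := by
    have h' := M.med_assoc z₂ z u₂ z u₁
    rw [M.med_swap_left z₂ z u₂, k₂, M.med_self_left, M.med_swap_left u₂ z u₁,
      M.med_swap_left z₂ z, M.med_swap_right z u₂ u₁] at h'
    exact h'.symm
  have h := M.med_assoc z z₁ z₂ z w
  rw [M.med_rotate z z₁ z₂, hz] at h
  rw [M.med_self_left, M.med_swap_left z₁, M.med_swap_left z₂, w₁, w₂, M.med_idem] at h
  exact h.symm

/-- If `[a, b]` meets a convex set `C`, then a point joining both `a` and `b` to `C` lies in `C`. -/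
theorem mem_of_crossing_intervals {C : Set X} (hC : M.IsConvex C) {a b c c₁ c₂ x : X}
    (hc : c ∈ C) (h₁ : c₁ ∈ C) (h₂ : c₂ ∈ C) (hab : M.med a b c = c)
    (e₁ : M.med a c₁ x = x) (e₂ : M.med b c₂ x = x) : x ∈ C := by
  set q := M.med c₁ c₂ x with hq
  have ha : M.med a x q = x := by
    rw [hq, M.med_swap_left c₁, M.med_distrib, M.med_swap_right a x c₁, e₁, M.med_idem, M.med_idem]
  have hb : M.med b x q = x := by
    rw [hq, M.med_distrib, M.med_swap_right b x c₂, e₂, M.med_idem, M.med_idem]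
  have h := M.med_assoc c a b x q
  rw [M.med_rotate c a b, hab, ha, hb, M.med_idem, M.med_swap_right] at h
  exact h ▸ hC.med_mem hc (hC.med_mem h₁ h₂ x) x

/-- Distinct points of a median algebra are separated by a halfspace. -/
theorem exists_halfspace_separating {x y : X} (hxy : x ≠ y) :
    ∃ H, M.IsHalfspace H ∧ y ∈ H ∧ x ∉ H := by
  obtain ⟨C, hyC, hmax⟩ := zorn_subset_nonempty {C : Set X | M.IsConvex C ∧ x ∉ C}
    (by
      intro c hc hchain _
      refine ⟨⋃₀ c, ⟨?_, ?_⟩, fun s hs => subset_sUnion_of_mem hs⟩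
      · rintro u ⟨s, hs, hu⟩ v ⟨t, ht, hv⟩
        rcases hchain.total hs ht with h | h
        · exact ((hc ht).1 u (h hu) v hv).trans (subset_sUnion_of_mem ht)
        · exact ((hc hs).1 u hu v (h hv)).trans (subset_sUnion_of_mem hs)
      · rintro ⟨s, hs, hx⟩
        exact (hc hs).2 hx)
    {y} (by
      refine ⟨?_, hxy⟩
      rintro u rfl v rfl z hz
      exact (hz.symm.trans (M.med_self_left _ _)))
  have hy : y ∈ C := hyC rfl
  obtain ⟨hC, hxC⟩ := hmax.prop
  have join : ∀ a ∉ C, ∃ c ∈ C, M.med a c x = x := by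
    intro a ha
    by_contra hx
    have hle := hmax.le_of_ge (y := {z | ∃ c ∈ C, M.med a c z = z}) ⟨hC.join_point a, hx⟩
      (fun c hc => ⟨c, hc, M.med_idem a c⟩)
    exact ha (hle ⟨y, hy, M.med_self_outer a y⟩)
  refine ⟨C, ⟨hC, ?_⟩, hy, hxC⟩
  intro a ha b hb c hc hcC
  obtain ⟨c₁, h₁, e₁⟩ := join a ha
  obtain ⟨c₂, h₂, e₂⟩ := join b hb
  exact hxC (mem_of_crossing_intervals hC hcC h₁ h₂ hc e₁ e₂)

theorem ext_halfspace {x y : X} (h : ∀ H, M.IsHalfspace H → (x ∈ H ↔ y ∈ H)) : x = y := by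
  by_contra hxy
  obtain ⟨H, hH, hy, hx⟩ := exists_halfspace_separating (M := M) hxy
  exact hx ((h H hH).2 hy)

theorem IsConvex.med_mem_of_two {C : Set X} (hC : M.IsConvex C) {x y z : X}
    (h : (x ∈ C ∧ y ∈ C) ∨ (y ∈ C ∧ z ∈ C) ∨ (x ∈ C ∧ z ∈ C)) : M.med x y z ∈ C := by
  rcases h with ⟨hx, hy⟩ | ⟨hy, hz⟩ | ⟨hx, hz⟩
  · exact hC.med_mem hx hy z
  · exact M.med_rotate x y z ▸ hC.med_mem hy hz x
  · exact M.med_swap_right x y z ▸ hC.med_mem hx hz y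

/-- Membership of a median in a halfspace is decided by majority. -/
theorem IsHalfspace.med_mem_iff {H : Set X} (hH : M.IsHalfspace H) (x y z : X) :
    M.med x y z ∈ H ↔ (x ∈ H ∧ y ∈ H) ∨ (y ∈ H ∧ z ∈ H) ∨ (x ∈ H ∧ z ∈ H) := by
  refine ⟨fun h => ?_, hH.1.med_mem_of_two⟩
  by_contra hn
  refine hH.2.med_mem_of_two (x := x) (y := y) (z := z) ?_ h
  simp only [mem_compl_iff]
  tauto

/-- The gate of a point in the convex hull of a finite nonempty set, described by halfspaces. -/
theorem exists_gate {s : Finset X} (hs : s.Nonempty) (x : X) :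
    ∃ g, ∀ H, M.IsHalfspace H → (g ∈ H ↔ (x ∈ H ∧ ∃ a ∈ s, a ∈ H) ∨ ∀ a ∈ s, a ∈ H) := by
  classical
  induction hs using Finset.Nonempty.cons_induction with
  | singleton a => exact ⟨a, fun H _ => by simp⟩
  | cons a s ha hs ih =>
    obtain ⟨g, hg⟩ := ih
    refine ⟨M.med x a g, fun H hH => ?_⟩
    rw [hH.med_mem_iff, hg H hH]
    obtain ⟨b, hb⟩ := hs
    have : (∀ a ∈ s, a ∈ H) → ∃ a ∈ s, a ∈ H := fun h => ⟨b, hb, h b hb⟩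
    simp only [Finset.mem_cons, exists_eq_or_imp, forall_eq_or_imp]
    generalize (∃ a ∈ s, a ∈ H) = p at *
    generalize (∀ a ∈ s, a ∈ H) = q at *
    tauto

theorem exists_gate_range {ι : Type*} [Finite ι] [Nonempty ι] (a : ι → X) (x : X) :
    ∃ g, ∀ H, M.IsHalfspace H → (g ∈ H ↔ (x ∈ H ∧ ∃ i, a i ∈ H) ∨ ∀ i, a i ∈ H) := by
  classical
  have := Fintype.ofFinite ι
  simpa using exists_gate (M := M) (Finset.univ_nonempty.image a) x

/-- A map from a cube is median-preserving when the preimage of each halfspace respects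
majority. -/
theorem isMedianHom_of_halfspaces {k : ℕ} {f : (Fin k → Bool) → X}
    (h : ∀ H, M.IsHalfspace H → ∀ u v w, f ((boolCubeMed (Fin k)).med u v w) ∈ H ↔
      (f u ∈ H ∧ f v ∈ H) ∨ (f v ∈ H ∧ f w ∈ H) ∨ (f u ∈ H ∧ f w ∈ H)) :
    IsMedianHom (boolCubeMed (Fin k)) M f := fun u v w =>
  ext_halfspace fun H hH => by rw [h H hH, hH.med_mem_iff]

/-- Halfspaces realizing all sign patterns at points `x v` are the coordinate halfspaces of a cube
contained in the convex hull of these points. -/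
theorem exists_cube {k : ℕ} (H : Fin k → Set X) (hH : ∀ i, M.IsHalfspace (H i))
    (x : (Fin k → Bool) → X) (hx : ∀ v i, x v ∈ H i ↔ v i = true) :
    ∃ f : (Fin k → Bool) → X, IsMedianHom (boolCubeMed (Fin k)) M f ∧
      (∀ v i, f v ∈ H i ↔ v i = true) ∧
      ∀ K, M.IsHalfspace K → (∀ v, x v ∈ K) → ∀ v, f v ∈ K := by
  induction k with
  | zero =>
    refine ⟨x, fun u v w => ?_, hx, fun K _ h => h⟩
    rw [Subsingleton.elim v u, Subsingleton.elim w u, M.med_idem, MedianStruct.med_idem]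
  | succ k ih =>
    let a : (Fin k → Bool) → X := fun w => x (Fin.cons false w)
    let b : (Fin k → Bool) → X := fun w => x (Fin.cons true w)
    choose pA hpA using exists_gate_range (M := M) a
    choose pB hpB using exists_gate_range (M := M) b
    have ha0 : ∀ w, a w ∉ H 0 := fun w => by simp [a, hx]
    have hb0 : ∀ w, b w ∈ H 0 := fun w => by simp [b, hx]
    have ha : ∀ w i, a w ∈ H (Fin.succ i) ↔ w i = true := fun w i => by simp [a, hx]
    have hb : ∀ w i, b w ∈ H (Fin.succ i) ↔ w i = true := fun w i => by simp [b, hx]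
    have hya : ∀ w i, pA (b w) ∈ H (Fin.succ i) ↔ w i = true := fun w i => by
      rw [hpA _ _ (hH _)]
      simp only [ha, hb]
      exact ⟨fun h => h.elim (fun h => h.1) fun h => h w, fun h => Or.inl ⟨h, w, h⟩⟩
    obtain ⟨g, hg, hgH, hgK⟩ := ih (fun i => H i.succ) (fun i => hH _) (fun w => pA (b w)) hya
    have hgK' : ∀ K, M.IsHalfspace K → (∀ w, pA (b w) ∉ K) → ∀ w, g w ∉ K := fun K hK h =>
      hgK Kᶜ ⟨hK.2, by rw [compl_compl]; exact hK.1⟩ h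
    let f : (Fin (k + 1) → Bool) → X := fun v =>
      if v 0 then pB (g (Fin.tail v)) else g (Fin.tail v)
    have fcases : ∀ K, M.IsHalfspace K →
        (∀ v, f v ∈ K) ∨ (∀ v, f v ∉ K) ∨ (∀ v, f v ∈ K ↔ v 0 = true) ∨
        (∀ v, f v ∈ K ↔ v 0 = false) ∨ ∀ v, f v ∈ K ↔ g (Fin.tail v) ∈ K := by
      intro K hK
      have hy := fun w => hpA (b w) K hK
      have hz := fun w => hpB (g w) K hK
      have hf : ∀ v, f v ∈ K ↔
          (v 0 = true ∧ pB (g (Fin.tail v)) ∈ K) ∨ (v 0 = false ∧ g (Fin.tail v) ∈ K) := by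
        intro v
        cases h : v 0 <;> simp [f, h]
      have of_const : (∀ w, g w ∈ K) ∨ (∀ w, g w ∉ K) →
          (∀ w, pB (g w) ∈ K) ∨ (∀ w, pB (g w) ∉ K) →
        (∀ v, f v ∈ K) ∨ (∀ v, f v ∉ K) ∨ (∀ v, f v ∈ K ↔ v 0 = true) ∨
        (∀ v, f v ∈ K ↔ v 0 = false) ∨ ∀ v, f v ∈ K ↔ g (Fin.tail v) ∈ K := by
        rintro (h | h) (h' | h')
        · exact Or.inl fun v => by cases hv : v 0 <;> simp [hf, h, h', hv]
        · exact Or.inr <| Or.inr <| Or.inr <| Or.inl fun v => by simp [hf, h, h']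
        · exact Or.inr <| Or.inr <| Or.inl fun v => by simp [hf, h, h']
        · exact Or.inr <| Or.inl fun v => by simp [hf, h, h']
      by_cases hB : ∀ w, b w ∈ K
      · refine of_const ?_ (Or.inl fun w => (hz w).2 (Or.inr hB))
        by_cases hA : ∃ w, a w ∈ K
        · exact Or.inl (hgK K hK fun w => (hy w).2 (Or.inl ⟨hB w, hA⟩))
        · exact Or.inr (hgK' K hK fun w h =>
            ((hy w).1 h).elim (fun h => hA h.2) fun h => hA ⟨w, h w⟩)
      · by_cases hB' : ∃ w, b w ∈ K
        · have hzg : ∀ w, pB (g w) ∈ K ↔ g w ∈ K := fun w => by rw [hz]; tauto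
          exact Or.inr <| Or.inr <| Or.inr <| Or.inr fun v => by
            cases hv : v 0 <;> simp [hf, hzg, hv]
        · refine of_const ?_ (Or.inr fun w h => ?_)
          · by_cases hA : ∀ w, a w ∈ K
            · exact Or.inl (hgK K hK fun w => (hy w).2 (Or.inr hA))
            · exact Or.inr (hgK' K hK fun w h => ((hy w).1 h).elim (fun h => hB' ⟨w, h.1⟩) hA)
          · exact ((hz w).1 h).elim (fun h => hB' h.2) hB
    refine ⟨f, isMedianHom_of_halfspaces fun K hK u v w => ?_, ?_, ?_⟩
    · have h0 : (boolCubeMed (Fin (k + 1))).med u v w 0 = boolMed (u 0) (v 0) (w 0) := rfl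
      have ht : Fin.tail ((boolCubeMed (Fin (k + 1))).med u v w) =
        (boolCubeMed (Fin k)).med (Fin.tail u) (Fin.tail v) (Fin.tail w) := rfl
      rcases fcases K hK with h | h | h | h | h
      · simp [h]
      · simp [h]
      · simp only [h, h0]
        cases u 0 <;> cases v 0 <;> cases w 0 <;> decide
      · simp only [h, h0]
        cases u 0 <;> cases v 0 <;> cases w 0 <;> decide
      · simp only [h, ht]
        rw [hg, hK.med_mem_iff]
    · have g0 : ∀ w, g w ∉ H 0 := hgK' _ (hH 0) fun w => by rw [hpA _ _ (hH 0)]; simp [ha0]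
      have p0 : ∀ w, pB (g w) ∈ H 0 := fun w => (hpB _ _ (hH 0)).2 (Or.inr hb0)
      have gp : ∀ w i, pB (g w) ∈ H (Fin.succ i) ↔ w i = true := fun w i => by
        rw [hpB _ _ (hH _)]
        simp only [hb, hgH]
        exact ⟨fun h => h.elim (fun h => h.1) fun h => h w, fun h => Or.inl ⟨h, w, h⟩⟩
      intro v i
      refine Fin.cases ?_ (fun j => ?_) i
      · cases hv : v 0 <;> simp [f, hv, g0, p0]
      · cases hv : v 0 <;> simp [f, hv, gp, hgH, Fin.tail]
    · intro K hK hxK v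
      have hgK₁ : ∀ w, g w ∈ K := hgK K hK fun w => (hpA _ _ hK).2 (Or.inr fun _ => hxK _)
      have hpK : ∀ w, pB (g w) ∈ K := fun w => (hpB _ _ hK).2 (Or.inr fun _ => hxK _)
      cases hv : v 0 <;> simp [f, hv, hgK₁, hpK]

end MedianStruct

/-- The dual halfspace system shatters a set of size `k` if and only if the `k`-cube embeds. -/
theorem exists_shatters_iff_cube_embeds {X : Type*} (M : MedianStruct X) (k : ℕ) :
    (∃ S : Finset {H : Set X | M.IsHalfspace H}, S.card = k ∧
      Shatters (dualSystem {H : Set X | M.IsHalfspace H}) S) ↔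
    ∃ f : (Fin k → Bool) → X,
      Function.Injective f ∧ IsMedianHom (boolCubeMed (Fin k)) M f := by
  classical
  constructor
  · rintro ⟨S, hS, hsh⟩
    let e := S.equivFinOfCardEq hS
    have hx : ∀ v : Fin k → Bool, ∃ x : X, ∀ i, x ∈ ((e.symm i).1 : Set X) ↔ v i = true := by
      intro v
      obtain ⟨_, ⟨x, rfl⟩, h⟩ := hsh {C | ∃ h : C ∈ S, v (e ⟨C, h⟩) = true} fun C hC => hC.1
      refine ⟨x, fun i => ?_⟩
      have := Set.ext_iff.1 h (e.symm i).1
      simpa using this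
    choose x hx using hx
    obtain ⟨f, hf, hfH, -⟩ :=
      MedianStruct.exists_cube (fun i => ((e.symm i).1 : Set X)) (fun i => (e.symm i).1.2) x hx
    refine ⟨f, fun u v huv => funext fun i => ?_, hf⟩
    rw [Bool.eq_iff_iff, ← hfH u i, ← hfH v i, huv]
  · rintro ⟨f, hinj, hf⟩
    have hne : ∀ i : Fin k, f (fun _ => false) ≠ f (Pi.single i true) := fun i h => by
      simpa using congrFun (hinj h) i
    choose H hH h1 h0 using fun i => MedianStruct.exists_halfspace_separating (M := M) (hne i)
    have hmed : ∀ v i, M.med (f (fun _ => false)) (f (Pi.single i true)) (f v) =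
        if v i then f (Pi.single i true) else f (fun _ => false) := by
      intro v i
      rw [← hf, ← apply_ite f]
      congr 1
      funext j
      change boolMed _ _ _ = _
      by_cases hij : j = i
      · subst hij
        cases hv : v j <;> simp [boolMed]
      · cases hv : v i <;> simp [boolMed, hij]
    have hmem : ∀ v i, f v ∈ H i ↔ v i = true := by
      intro v i
      have h := (hH i).med_mem_iff (f (fun _ => false)) (f (Pi.single i true)) (f v)
      rw [hmed] at h
      cases hv : v i <;> simp_all
    have hHinj : Function.Injective H := fun i j hij => by
      by_contra hne
      have := (hmem (Pi.single i true) j).1 (hij ▸ h1 i)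
      simp [Ne.symm hne] at this
    let F : Fin k → {H : Set X | M.IsHalfspace H} := fun i => ⟨H i, hH i⟩
    have hF : Function.Injective F := fun i j h => hHinj (congrArg Subtype.val h)
    refine ⟨Finset.univ.image F, by simp [Finset.card_image_of_injective _ hF], fun T hT => ?_⟩
    refine ⟨_, ⟨f fun i => decide (F i ∈ T), rfl⟩, ?_⟩
    ext C
    constructor
    · rintro ⟨hC, hCS⟩
      obtain ⟨i, -, rfl⟩ := Finset.mem_image.1 (Finset.mem_coe.1 hCS)
      simpa using (hmem _ i).1 hC
    · intro hC
      refine ⟨?_, hT hC⟩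
      obtain ⟨i, -, rfl⟩ := Finset.mem_image.1 (Finset.mem_coe.1 (hT hC))
      exact (hmem _ i).2 (by simpa using hC)

/-- for a median algebra of finite rank `n`, the VC-dimension of
the dual of the halfspace system equals `n`. -/
theorem vcDim_dual_halfspaces_eq_rank {X : Type*} (M : MedianStruct X) (n : ℕ)
    (hrank : medRank M = (n : ℕ∞)) :
    vcDim (dualSystem {H : Set X | M.IsHalfspace H}) = (n : ℕ∞) := by
  rw [← hrank]
  exact iSup_congr fun k => iSup_congr_Prop (exists_shatters_iff_cube_embeds M k) fun _ => rfl
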